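/- Let K be a field, n ≥ 2 an integer, and A an n×n matrix over K. Let σ₁ : Mₙ(K) → K be a K-linear functional with σ₁(Id) = 0, and let s₂, …, s_{n−1} ∈ K be scalars satisfying, for each integer m with 2 ≤ m ≤ n−1, the recursion σ₁(A^m) = σ₁(A)·tr(Sym^{m−1} A) + Σ_{j=2}^{m} (−1)^{j−1} s_j · tr(Sym^{m−j} A). Then for every integer k ≥ 0, σ₁(A^{k+1}) = σ₁(A)·tr(Sym^k A) + Σ_{j=2}^{n−1} (−1)^{j−1} s_j · tr(Sym^{k+1−j} A). -/

import Mathlib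

open MvPolynomial Finset

/-- The endomorphism induced by the matrix `A` on the space of homogeneous polynomials of
degree `k` in `n` variables (a model for the `k`-th symmetric power of `K^n`). -/
noncomputable def symPowMap {K : Type*} [Field K] {n : ℕ} (A : Matrix (Fin n) (Fin n) K) (k : ℕ) :
    homogeneousSubmodule (Fin n) K k →ₗ[K] homogeneousSubmodule (Fin n) K k :=
  LinearMap.restrict
    (MvPolynomial.aeval fun i => ∑ j, A i j • X j :
      MvPolynomial (Fin n) K →ₐ[K] MvPolynomial (Fin n) K).toLinearMap
    (fun p hp => by
      rw [mem_homogeneousSubmodule] at hp ⊢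
      have hg : ∀ i : Fin n, (∑ j, A i j • X j : MvPolynomial (Fin n) K).IsHomogeneous 1 := by
        intro i
        apply IsHomogeneous.sum
        intro j _
        rw [smul_eq_C_mul]
        exact (isHomogeneous_X K j).C_mul (A i j)
      have := hp.aeval (fun i => ∑ j, A i j • X j) hg
      simpa using this)

/-- `trSymPow A k = tr(Sym^k A)`, the trace of the `k`-th symmetric power of `A`. -/
noncomputable def trSymPow {K : Type*} [Field K] {n : ℕ} (A : Matrix (Fin n) (Fin n) K)
    (k : ℕ) : K :=
  LinearMap.trace K _ (symPowMap A k)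

/-- `tr(Sym^k A)` for an integer index, with the convention `tr(Sym^k A) = 0` for `k < 0`. -/
noncomputable def trSymPowZ {K : Type*} [Field K] {n : ℕ} (A : Matrix (Fin n) (Fin n) K)
    (k : ℤ) : K :=
  if 0 ≤ k then trSymPow A k.toNat else 0

section SymPowTrace

variable {K : Type*} [Field K] {n : ℕ}

/-- The monomials of degree `k` form a basis of the homogeneous polynomials of degree `k`. -/
noncomputable def homogeneousMonomialBasis (K : Type*) [Field K] (n k : ℕ) :
    Module.Basis {d : Fin n →₀ ℕ | d.degree = k} K (homogeneousSubmodule (Fin n) K k) :=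
  (basisRestrictSupport K {d : Fin n →₀ ℕ | d.degree = k}).map
    (LinearEquiv.ofEq _ _ (homogeneousSubmodule_eq_finsupp_supported (Fin n) K k).symm)

lemma homogeneousMonomialBasis_repr_apply {k : ℕ} (p : homogeneousSubmodule (Fin n) K k)
    (d : {d : Fin n →₀ ℕ | d.degree = k}) :
    (homogeneousMonomialBasis K n k).repr p d = coeff d.1 p.1 :=
  rfl

lemma coe_homogeneousMonomialBasis_apply {k : ℕ} (d : {d : Fin n →₀ ℕ | d.degree = k}) :
    (homogeneousMonomialBasis K n k d : MvPolynomial (Fin n) K) = monomial d.1 1 := by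
  ext e
  by_cases he : e.degree = k
  · rw [← homogeneousMonomialBasis_repr_apply _ ⟨e, he⟩, Module.Basis.repr_self, coeff_monomial,
      Finsupp.single_apply]
    simp only [Subtype.ext_iff]
  · rw [coeff_monomial, if_neg (fun h => he (by rw [← h]; exact d.2))]
    by_contra h
    have := (mem_homogeneousSubmodule k _).1 (homogeneousMonomialBasis K n k d).2 h
    exact he (by rwa [Finsupp.degree_eq_weight_one])

/-- The trace of a symmetric power as the sum of its diagonal entries in the monomial basis. -/
lemma trSymPow_eq_sum_coeff (A : Matrix (Fin n) (Fin n) K) (k : ℕ) :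
    trSymPow A k = ∑ d ∈ (univ : Finset (Fin n)).finsuppAntidiag k,
      coeff d (∏ i, (∑ j, A i j • X j : MvPolynomial (Fin n) K) ^ d i) := by
  classical
  have hmem (d : Fin n →₀ ℕ) :
      d ∈ (univ : Finset (Fin n)).finsuppAntidiag k ↔ d ∈ {d : Fin n →₀ ℕ | d.degree = k} := by
    simp [Finsupp.degree_eq_sum]
  let _ : Fintype {d : Fin n →₀ ℕ | d.degree = k} := Fintype.subtype _ hmem
  rw [trSymPow, LinearMap.trace_eq_matrix_trace K (homogeneousMonomialBasis K n k),
    Matrix.trace, Finset.sum_subtype _ hmem]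
  refine Finset.sum_congr rfl fun d _ => ?_
  rw [Matrix.diag_apply, LinearMap.toMatrix_apply, homogeneousMonomialBasis_repr_apply, symPowMap,
    LinearMap.coe_restrict_apply, coe_homogeneousMonomialBasis_apply, AlgHom.toLinearMap_apply,
    aeval_monomial, map_one, one_mul, Finsupp.prod_fintype _ _ (fun _ => pow_zero _)]

lemma trSymPow_map {L : Type*} [Field L] (f : K →+* L) (A : Matrix (Fin n) (Fin n) K) (k : ℕ) :
    trSymPow (A.map f) k = f (trSymPow A k) := by
  rw [trSymPow_eq_sum_coeff, trSymPow_eq_sum_coeff, map_sum]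
  refine Finset.sum_congr rfl fun d _ => ?_
  rw [← coeff_map]
  simp [smul_eq_C_mul]

lemma symPowMap_mul (A B : Matrix (Fin n) (Fin n) K) (k : ℕ) :
    symPowMap (A * B) k = symPowMap B k * symPowMap A k := by
  have h : (aeval fun i => ∑ j, (A * B) i j • X j :
        MvPolynomial (Fin n) K →ₐ[K] MvPolynomial (Fin n) K) =
      (aeval fun i => ∑ j, B i j • X j).comp (aeval fun i => ∑ j, A i j • X j) := by
    refine algHom_ext fun i => ?_
    simp only [AlgHom.comp_apply, aeval_X, map_sum, map_smul, Matrix.mul_apply, Finset.sum_smul,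
      Finset.smul_sum, smul_smul]
    exact Finset.sum_comm
  refine LinearMap.ext fun p => Subtype.ext ?_
  exact DFunLike.congr_fun h p.1

lemma trSymPow_mul_comm (A B : Matrix (Fin n) (Fin n) K) (k : ℕ) :
    trSymPow (A * B) k = trSymPow (B * A) k := by
  rw [trSymPow, trSymPow, symPowMap_mul, symPowMap_mul, LinearMap.trace_mul_comm]

/-- Symmetric power traces of a block upper triangular matrix with a `1 × 1` leading block. -/
lemma trSymPow_of_column_zero (A : Matrix (Fin (n + 1)) (Fin (n + 1)) K)
    (hA : ∀ i : Fin n, A i.succ 0 = 0) (k : ℕ) :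
    trSymPow A k = ∑ p ∈ antidiagonal k,
      A 0 0 ^ p.1 * trSymPow (A.submatrix Fin.succ Fin.succ) p.2 := by
  simp only [trSymPow_eq_sum_coeff, Finset.mul_sum]
  rw [Finset.sum_sigma']
  symm
  refine Finset.sum_bij' (fun x _ => Finsupp.cons x.1.1 x.2)
    (fun d _ => ⟨(d 0, k - d 0), Finsupp.tail d⟩) ?_ ?_ ?_ ?_ ?_
  · rintro ⟨⟨a, b⟩, d⟩ h
    simp only [mem_sigma, HasAntidiagonal.mem_antidiagonal, mem_finsuppAntidiag,
      subset_univ, and_true] at h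
    simp [Fin.sum_univ_succ, h.1, h.2]
  · intro d h
    simp only [mem_finsuppAntidiag, subset_univ, and_true, Fin.sum_univ_succ] at h
    simp only [mem_sigma, HasAntidiagonal.mem_antidiagonal, mem_finsuppAntidiag,
      subset_univ, and_true]
    have htail : univ.sum (Finsupp.tail d) = ∑ i : Fin n, d i.succ := rfl
    omega
  · rintro ⟨⟨a, b⟩, d⟩ h
    simp only [mem_sigma, HasAntidiagonal.mem_antidiagonal] at h
    obtain rfl : b = k - a := by omega
    simp
  · intro d _
    simp
  · rintro ⟨⟨a, b⟩, d⟩ _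
    rw [← finSuccEquiv_coeff_coeff]
    set q : MvPolynomial (Fin n) K :=
      ∏ i, (∑ j, A.submatrix Fin.succ Fin.succ i j • X j : MvPolynomial (Fin n) K) ^ d i with hq
    have hprod : finSuccEquiv K n
        (∏ i, (∑ j, A i j • X j : MvPolynomial (Fin (n + 1)) K) ^ (Finsupp.cons a d) i) =
        (Polynomial.C (C (A 0 0)) * Polynomial.X
          + Polynomial.C (∑ j : Fin n, A 0 j.succ • X j)) ^ a * Polynomial.C q := by
      have hs (c : K) (p : MvPolynomial (Fin n) K) :
          c • Polynomial.C p = Polynomial.C (c • p) := Polynomial.smul_C c p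
      have hX : A 0 0 • (Polynomial.X : Polynomial (MvPolynomial (Fin n) K)) =
          Polynomial.C (C (A 0 0)) * Polynomial.X := by
        rw [← mul_one (C (A 0 0)), ← smul_eq_C_mul, ← hs, Polynomial.C_1, smul_mul_assoc, one_mul]
      simp [hq, Fin.prod_univ_succ, Fin.sum_univ_succ, hA, finSuccEquiv_X_zero,
        finSuccEquiv_X_succ, hs, hX]
    rw [hprod, Polynomial.coeff_mul_C]
    have hdeg : (Polynomial.C (C (A 0 0)) * Polynomial.X
        + Polynomial.C (∑ j : Fin n, A 0 j.succ • X j)).natDegree ≤ 1 :=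
      Polynomial.natDegree_linear_le
    have hc := Polynomial.coeff_pow_of_natDegree_le hdeg (m := a)
    rw [mul_one] at hc
    rw [hc, Polynomial.coeff_add, Polynomial.coeff_C_mul, Polynomial.coeff_X_one, mul_one,
      Polynomial.coeff_C_of_ne_zero one_ne_zero, add_zero, ← C_pow, coeff_C_mul]

/-- A nonzero vector is the zeroth column of an invertible matrix. -/
lemma exists_inverse_pair_mulVec_single_eq {v : Fin (n + 1) → K} (hv : v ≠ 0) :
    ∃ P Q : Matrix (Fin (n + 1)) (Fin (n + 1)) K, Q * P = 1 ∧ P * Q = 1 ∧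
      P.mulVec (Pi.single 0 1) = v := by
  have he : (Pi.single 0 1 : Fin (n + 1) → K) ≠ 0 := by simp
  obtain ⟨g, hg⟩ := Submodule.exists_linearEquiv_restrict_eq
    ((LinearEquiv.toSpanNonzeroSingleton K _ _ he).symm ≪≫ₗ
      LinearEquiv.toSpanNonzeroSingleton K _ _ hv)
  refine ⟨LinearMap.toMatrix' g.toLinearMap, LinearMap.toMatrix' g.symm.toLinearMap, ?_, ?_, ?_⟩
  · rw [← LinearMap.toMatrix'_comp]; simp
  · rw [← LinearMap.toMatrix'_comp]; simp
  · rw [LinearMap.toMatrix'_mulVec]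
    have := hg (LinearEquiv.toSpanNonzeroSingleton K _ _ he 1)
    rw [LinearEquiv.trans_apply, LinearEquiv.symm_apply_apply] at this
    simpa only [LinearEquiv.toSpanNonzeroSingleton_apply, one_smul,
      LinearEquiv.coe_coe] using this.symm

lemma exists_similar_column_zero [IsAlgClosed K] (A : Matrix (Fin (n + 1)) (Fin (n + 1)) K) :
    ∃ P Q : Matrix (Fin (n + 1)) (Fin (n + 1)) K, P * Q = 1 ∧
      ∀ i : Fin n, (Q * (A * P)) i.succ 0 = 0 := by
  obtain ⟨c, hc⟩ := Module.End.exists_eigenvalue (Matrix.toLin' A)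
  obtain ⟨v, hv⟩ := hc.exists_hasEigenvector
  obtain ⟨P, Q, hQP, hPQ, hP⟩ := exists_inverse_pair_mulVec_single_eq hv.2
  refine ⟨P, Q, hPQ, fun i => ?_⟩
  have hcol : (Q * (A * P)).mulVec (Pi.single 0 1) = c • Pi.single 0 1 := by
    have hAv : A.mulVec v = c • v := by simpa using hv.apply_eq_smul
    rw [← Matrix.mulVec_mulVec, ← Matrix.mulVec_mulVec, hP, hAv, Matrix.mulVec_smul, ← hP,
      Matrix.mulVec_mulVec, hQP, Matrix.one_mulVec]
  simpa using congrFun hcol i.succ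

lemma charpolyRev_mul_comm (A B : Matrix (Fin n) (Fin n) K) :
    (A * B).charpolyRev = (B * A).charpolyRev := by
  rw [← Matrix.reverse_charpoly, ← Matrix.reverse_charpoly, Matrix.charpoly_mul_comm]

lemma charpolyRev_of_column_zero (A : Matrix (Fin (n + 1)) (Fin (n + 1)) K)
    (hA : ∀ i : Fin n, A i.succ 0 = 0) :
    A.charpolyRev = (1 - Polynomial.C (A 0 0) * Polynomial.X) *
      (A.submatrix Fin.succ Fin.succ).charpolyRev := by
  rw [Matrix.charpolyRev, Matrix.det_succ_column_zero, Fin.sum_univ_succ,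
    Finset.sum_eq_zero fun i _ => by simp [hA]]
  rw [add_zero, Matrix.charpolyRev]
  congr 1
  · simp only [Fin.val_zero, pow_zero, one_mul, Matrix.sub_apply, Matrix.one_apply_eq,
      Matrix.smul_apply, Matrix.map_apply, smul_eq_mul]
    rw [mul_comm Polynomial.X]
  · congr 1
    ext1 i j
    simp [Matrix.one_apply]

lemma mk_trSymPow_mul_charpolyRev_of_isAlgClosed [IsAlgClosed K] :
    ∀ {n : ℕ} (A : Matrix (Fin n) (Fin n) K),
      PowerSeries.mk (trSymPow A) * (A.charpolyRev : PowerSeries K) = 1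
  | 0, A => by
    have h : PowerSeries.mk (trSymPow A) = 1 := by
      ext k
      rw [PowerSeries.coeff_mk, trSymPow_eq_sum_coeff, univ_eq_empty, finsuppAntidiag_empty,
        PowerSeries.coeff_one]
      split_ifs <;> simp
    rw [h, Matrix.charpolyRev, Matrix.det_isEmpty, Polynomial.coe_one, one_mul]
  | n + 1, A => by
    obtain ⟨P, Q, hPQ, hcol⟩ := exists_similar_column_zero A
    have hA : A = (A * P) * Q := by rw [Matrix.mul_assoc, hPQ, Matrix.mul_one]
    set B := Q * (A * P)
    have htr : trSymPow A = trSymPow B := by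
      funext k
      conv_lhs => rw [hA]
      exact trSymPow_mul_comm _ _ k
    have hdet : A.charpolyRev = B.charpolyRev := by
      conv_lhs => rw [hA]
      exact charpolyRev_mul_comm _ _
    have hmk : PowerSeries.mk (trSymPow B) = PowerSeries.mk (fun i => B 0 0 ^ i) *
        PowerSeries.mk (trSymPow (B.submatrix Fin.succ Fin.succ)) := by
      ext k
      simp [PowerSeries.coeff_mul, trSymPow_of_column_zero B hcol]
    have hgeom : PowerSeries.mk (fun i => B 0 0 ^ i) *
        (1 - PowerSeries.C (B 0 0) * PowerSeries.X) = 1 := by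
      ext k
      rw [mul_sub, mul_one, mul_left_comm, map_sub, PowerSeries.coeff_C_mul]
      cases k with
      | zero => simp
      | succ k => simp [PowerSeries.coeff_succ_mul_X, pow_succ', PowerSeries.coeff_one]
    rw [htr, hdet, hmk, charpolyRev_of_column_zero B hcol, Polynomial.coe_mul, Polynomial.coe_sub,
      Polynomial.coe_one, Polynomial.coe_mul, Polynomial.coe_C, Polynomial.coe_X,
      mul_mul_mul_comm, hgeom, one_mul, mk_trSymPow_mul_charpolyRev_of_isAlgClosed]

/-- The generating function of the traces of the symmetric powers of `A` is `1 / det (1 - t A)`. -/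
lemma mk_trSymPow_mul_charpolyRev (A : Matrix (Fin n) (Fin n) K) :
    PowerSeries.mk (trSymPow A) * (A.charpolyRev : PowerSeries K) = 1 := by
  let f := algebraMap K (AlgebraicClosure K)
  apply PowerSeries.map_injective f f.injective
  have hmk : PowerSeries.map f (PowerSeries.mk (trSymPow A)) =
      PowerSeries.mk (trSymPow (A.map f)) := by
    ext k
    simp [trSymPow_map]
  have hdet : PowerSeries.map f (A.charpolyRev : PowerSeries K) =
      ((A.map f).charpolyRev : PowerSeries (AlgebraicClosure K)) := by
    rw [← Polynomial.polynomial_map_coe, ← Matrix.reverse_charpoly, ← Matrix.reverse_charpoly,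
      Matrix.charpoly_map]
    congr 1
    ext k
    simp [Polynomial.coeff_reverse, Polynomial.natDegree_map]
  rw [map_mul, map_one, hmk, hdet, mk_trSymPow_mul_charpolyRev_of_isAlgClosed]

lemma trSymPow_zero (A : Matrix (Fin n) (Fin n) K) : trSymPow A 0 = 1 := by
  rw [trSymPow_eq_sum_coeff]
  simp

/-- The Cayley-Hamilton theorem as a linear recurrence for the powers of a matrix. -/
lemma coeff_charpolyRev_mul_mk_pow
    (A : Matrix (Fin n) (Fin n) K) (σ : Matrix (Fin n) (Fin n) K →ₗ[K] K) {m : ℕ} (hm : n ≤ m) :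
    PowerSeries.coeff m
      ((A.charpolyRev : PowerSeries K) * PowerSeries.mk fun i => σ (A ^ i)) = 0 := by
  have hdeg : A.charpoly.natDegree = n := by simp
  have hCH : ∑ i ∈ range (n + 1), A.charpoly.coeff i • A ^ i = 0 := by
    have := A.aeval_self_charpoly
    rwa [Polynomial.aeval_eq_sum_range, hdeg] at this
  have hzero (i : ℕ) (hi : n < i) : A.charpolyRev.coeff i = 0 := by
    rw [← Matrix.reverse_charpoly, Polynomial.coeff_reverse, hdeg,
      Polynomial.revAt_eq_self_of_lt hi]
    exact Polynomial.coeff_eq_zero_of_natDegree_lt (by omega)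
  rw [PowerSeries.coeff_mul, Finset.Nat.sum_antidiagonal_eq_sum_range_succ_mk]
  simp only [Polynomial.coeff_coe, PowerSeries.coeff_mk]
  rw [← Finset.sum_subset (range_mono (Nat.succ_le_succ hm)) fun i _ hi => by
    rw [hzero i (by simpa using hi), zero_mul], ← Finset.sum_range_reflect]
  have key : A ^ (m - n) * ∑ i ∈ range (n + 1), A.charpoly.coeff i • A ^ i = 0 := by
    rw [hCH, mul_zero]
  rw [← map_zero σ, ← key, Finset.mul_sum, map_sum]
  refine Finset.sum_congr rfl fun i hi => ?_
  have hi' : i ≤ n := Nat.lt_succ_iff.1 (mem_range.1 hi)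
  rw [Matrix.mul_smul, ← pow_add, map_smul, smul_eq_mul, ← Matrix.reverse_charpoly,
    Polynomial.coeff_reverse, hdeg, Polynomial.revAt_le (by omega)]
  congr 3 <;> omega

end SymPowTrace

theorem sigma_one_pow_eq_sym_trace_combination
    (K : Type*) [Field K] (n : ℕ) (hn : 2 ≤ n) (A : Matrix (Fin n) (Fin n) K)
    (σ₁ : Matrix (Fin n) (Fin n) K →ₗ[K] K) (hId : σ₁ 1 = 0) (s : ℕ → K)
    (hrec : ∀ m : ℕ, 2 ≤ m → m ≤ n - 1 →
      σ₁ (A ^ m) = σ₁ A * trSymPowZ A ((m : ℤ) - 1)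
        + ∑ j ∈ Finset.Icc 2 m, (-1 : K) ^ (j - 1) * s j * trSymPowZ A ((m : ℤ) - (j : ℤ))) :
    ∀ k : ℕ,
      σ₁ (A ^ (k + 1)) = σ₁ A * trSymPowZ A (k : ℤ)
        + ∑ j ∈ Finset.Icc 2 (n - 1),
            (-1 : K) ^ (j - 1) * s j * trSymPowZ A ((k : ℤ) + 1 - (j : ℤ)) := by
  set H : PowerSeries K := PowerSeries.mk (trSymPow A) with hH
  set D : PowerSeries K := (A.charpolyRev : PowerSeries K)
  have hHD : H * D = 1 := mk_trSymPow_mul_charpolyRev A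
  set F : PowerSeries K := PowerSeries.mk fun i => σ₁ (A ^ i) with hF
  set Q : PowerSeries K := PowerSeries.C (σ₁ A) * PowerSeries.X ^ 1 +
    ∑ j ∈ Finset.Icc 2 (n - 1), PowerSeries.C ((-1 : K) ^ (j - 1) * s j) * PowerSeries.X ^ j with hQ
  have hshift (m j : ℕ) :
      PowerSeries.coeff m (PowerSeries.X ^ j * H) = trSymPowZ A ((m : ℤ) - (j : ℤ)) := by
    rw [PowerSeries.coeff_X_pow_mul', trSymPowZ]
    by_cases hj : j ≤ m
    · rw [if_pos hj, if_pos (by omega), hH, PowerSeries.coeff_mk]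
      congr 1
      omega
    · rw [if_neg hj, if_neg (by omega)]
  have hG (m : ℕ) : PowerSeries.coeff m (Q * H) = σ₁ A * trSymPowZ A ((m : ℤ) - 1) +
      ∑ j ∈ Finset.Icc 2 (n - 1),
        (-1 : K) ^ (j - 1) * s j * trSymPowZ A ((m : ℤ) - (j : ℤ)) := by
    rw [hQ, add_mul, Finset.sum_mul, map_add, map_sum, mul_assoc, PowerSeries.coeff_C_mul, hshift]
    simp only [mul_assoc (PowerSeries.C _), PowerSeries.coeff_C_mul, hshift, Nat.cast_one]
  have hneg (z : ℤ) (hz : z < 0) : trSymPowZ A z = 0 := if_neg (by omega)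
  have hlow (m : ℕ) (hm : m < n) : PowerSeries.coeff m (F - Q * H) = 0 := by
    rw [map_sub, hG, hF, PowerSeries.coeff_mk, sub_eq_zero]
    by_cases h2 : 2 ≤ m
    · rw [hrec m h2 (by omega)]
      congr 1
      refine Finset.sum_subset (Finset.Icc_subset_Icc_right (by omega)) fun j _ hj => ?_
      rw [Finset.mem_Icc] at *
      rw [hneg _ (by omega), mul_zero]
    · rw [Finset.sum_eq_zero fun j hj => by
        rw [Finset.mem_Icc] at hj
        rw [hneg _ (by omega), mul_zero], add_zero]
      obtain rfl | rfl : m = 0 ∨ m = 1 := by omega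
      · rw [pow_zero, hId, hneg _ (by norm_num), mul_zero]
      · simp [trSymPowZ, trSymPow_zero]
  have hzero : D * (F - Q * H) = 0 := by
    ext m
    rw [map_zero]
    by_cases hm : m < n
    · rw [PowerSeries.coeff_mul]
      refine Finset.sum_eq_zero fun p hp => ?_
      rw [Finset.HasAntidiagonal.mem_antidiagonal] at hp
      rw [hlow p.2 (by omega), mul_zero]
    · rw [mul_sub, mul_left_comm, mul_comm D H, hHD, mul_one, map_sub,
        coeff_charpolyRev_mul_mk_pow A σ₁ (not_lt.1 hm), zero_sub, neg_eq_zero, hQ, map_add,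
        map_sum, PowerSeries.coeff_C_mul, PowerSeries.coeff_X_pow, if_neg (by omega), mul_zero,
        zero_add]
      refine Finset.sum_eq_zero fun j hj => ?_
      rw [Finset.mem_Icc] at hj
      rw [PowerSeries.coeff_C_mul, PowerSeries.coeff_X_pow, if_neg (by omega), mul_zero]
  have hFG : F = Q * H := by
    rw [← sub_eq_zero, ← one_mul (F - Q * H), ← hHD, mul_assoc, hzero, mul_zero]
  intro k
  have hk := congrArg (PowerSeries.coeff (k + 1)) hFG
  rw [hG, hF, PowerSeries.coeff_mk] at hk
  rw [hk]
  push_cast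
  rw [add_sub_cancel_right]
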